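/- For every L > 0 and all fixed k, n ∈ ℕ: ∫_{C_n(L) ∩ [0, k]} (r^k/k!) e^{-r} dr ≤ ∫_{C_n(L) + k} (r^k/k!) e^{-r} dr, where C_n(L) + k = {x + k : x ∈ C_n(L)}. -/

import Mathlib

open Real MeasureTheory

/-- The `n`-iterate mid-third Cantor set based in `[0, L]`:
`C₀(L) = [0,L]` and `C_{n+1}(L) = (1/3)·C_n(L) ∪ (2L/3 + (1/3)·C_n(L))`. -/
def cantorIterate : ℕ → ℝ → Set ℝ
  | 0, L => Set.Icc 0 L
  | n + 1, L =>
      (fun x => x / 3) '' cantorIterate n L ∪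
        (fun x => 2 * L / 3 + x / 3) '' cantorIterate n L

theorem cantorIterate_subset_Icc {L : ℝ} (hL : 0 ≤ L) (n : ℕ) :
    cantorIterate n L ⊆ Set.Icc 0 L := by
  induction n with
  | zero => exact subset_rfl
  | succ n ih =>
    rintro _ (⟨x, hx, rfl⟩ | ⟨x, hx, rfl⟩) <;> obtain ⟨h0, h1⟩ := ih hx <;>
      constructor <;> dsimp only <;> linarith

theorem isCompact_cantorIterate (L : ℝ) (n : ℕ) : IsCompact (cantorIterate n L) := by
  induction n with
  | zero => exact isCompact_Icc
  | succ n ih => exact (ih.image (by fun_prop)).union (ih.image (by fun_prop))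

theorem volume_real_image_add_div_three (c : ℝ) (s : Set ℝ) :
    volume.real ((fun x => c + x / 3) '' s) = volume.real s / 3 := by
  have h : (fun x => c + x / 3) '' s = (fun x => -c + x) ⁻¹' ((3 * ·) ⁻¹' s) := by
    ext y
    constructor
    · rintro ⟨x, hx, rfl⟩
      simpa [mul_div_cancel₀] using hx
    · intro hy
      exact ⟨3 * (-c + y), hy, by ring⟩
  rw [measureReal_def, h, measure_preimage_add, Real.volume_preimage_mul_left three_ne_zero,
    ENNReal.toReal_mul, ENNReal.toReal_ofReal (abs_nonneg _), measureReal_def,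
    abs_of_nonneg (by norm_num)]
  ring

/-- The distribution function `x ↦ |C_n(L) ∩ (-∞, x]|`, an unnormalized Cantor function. -/
noncomputable def cantorCdf (n : ℕ) (L x : ℝ) : ℝ :=
  volume.real (cantorIterate n L ∩ Set.Iic x)

theorem cantorCdf_nonneg (n : ℕ) (L x : ℝ) : 0 ≤ cantorCdf n L x := measureReal_nonneg

theorem cantorCdf_mono (n : ℕ) (L : ℝ) : Monotone (cantorCdf n L) := fun _ _ h =>
  measureReal_mono (Set.inter_subset_inter_right _ (Set.Iic_subset_Iic.2 h))
    (measure_inter_lt_top_of_left_ne_top (isCompact_cantorIterate L n).measure_lt_top.ne).ne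

theorem cantorCdf_of_nonpos {L : ℝ} (hL : 0 ≤ L) (n : ℕ) {x : ℝ} (hx : x ≤ 0) :
    cantorCdf n L x = 0 := by
  have h : cantorIterate n L ∩ Set.Iic x ⊆ {0} := fun y hy =>
    le_antisymm (le_trans hy.2 hx) (cantorIterate_subset_Icc hL n hy.1).1
  rw [cantorCdf, measureReal_def, measure_mono_null h (by simp), ENNReal.toReal_zero]

theorem cantorCdf_of_ge {L : ℝ} (hL : 0 ≤ L) (n : ℕ) {x : ℝ} (hx : L ≤ x) :
    cantorCdf n L x = cantorCdf n L L := by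
  have h : ∀ y, L ≤ y → cantorIterate n L ∩ Set.Iic y = cantorIterate n L := fun y hy =>
    Set.inter_eq_left.2 fun z hz => (cantorIterate_subset_Icc hL n hz).2.trans hy
  rw [cantorCdf, cantorCdf, h x hx, h L le_rfl]

theorem cantorCdf_zero (L x : ℝ) : cantorCdf 0 L x = max (min L x) 0 := by
  rw [cantorCdf, cantorIterate, ← Set.Ici_inter_Iic, Set.inter_assoc, Set.Iic_inter_Iic,
    Set.Ici_inter_Iic, Real.volume_real_Icc, sub_zero]

theorem cantorCdf_succ {L : ℝ} (hL : 0 < L) (n : ℕ) (x : ℝ) :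
    cantorCdf (n + 1) L x = (cantorCdf n L (3 * x) + cantorCdf n L (3 * x - 2 * L)) / 3 := by
  have hc := isCompact_cantorIterate L n
  have himg : ∀ c : ℝ, (fun y => c + y / 3) '' cantorIterate n L ∩ Set.Iic x =
      (fun y => c + y / 3) '' (cantorIterate n L ∩ Set.Iic (3 * x - 3 * c)) := by
    intro c
    ext z
    constructor
    · rintro ⟨⟨y, hy, rfl⟩, hz⟩
      refine ⟨y, ⟨hy, ?_⟩, rfl⟩
      simp only [Set.mem_Iic] at hz ⊢
      linarith
    · rintro ⟨y, ⟨hy, hz⟩, rfl⟩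
      refine ⟨⟨y, hy, rfl⟩, ?_⟩
      simp only [Set.mem_Iic] at hz ⊢
      linarith
  have hunion : cantorIterate (n + 1) L ∩ Set.Iic x =
      (fun y => 0 + y / 3) '' (cantorIterate n L ∩ Set.Iic (3 * x)) ∪
        (fun y => 2 * L / 3 + y / 3) '' (cantorIterate n L ∩ Set.Iic (3 * x - 2 * L)) := by
    have h0 := himg 0
    have h1 := himg (2 * L / 3)
    rw [mul_zero, sub_zero] at h0
    rw [mul_div_cancel₀ _ three_ne_zero] at h1
    rw [← h0, ← h1, ← Set.union_inter_distrib_right]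
    simp only [cantorIterate, zero_add]
  have hcompact : ∀ c y : ℝ,
      IsCompact ((fun z => c + z / 3) '' (cantorIterate n L ∩ Set.Iic y)) := fun c y =>
    (hc.inter_right isClosed_Iic).image (by fun_prop)
  have hdisj : Disjoint ((fun y => 0 + y / 3) '' (cantorIterate n L ∩ Set.Iic (3 * x)))
      ((fun y => 2 * L / 3 + y / 3) '' (cantorIterate n L ∩ Set.Iic (3 * x - 2 * L))) := by
    rw [Set.disjoint_left]
    rintro _ ⟨y, ⟨hy, -⟩, rfl⟩ ⟨z, ⟨hz, -⟩, h⟩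
    have h1 := (cantorIterate_subset_Icc hL.le n hy).2
    have h2 := (cantorIterate_subset_Icc hL.le n hz).1
    dsimp only at h
    linarith
  rw [cantorCdf, hunion, measureReal_union hdisj (hcompact _ _).measurableSet
    (hcompact _ _).measure_lt_top.ne (hcompact _ _).measure_lt_top.ne,
    volume_real_image_add_div_three, volume_real_image_add_div_three, cantorCdf, cantorCdf]
  ring

/-- Subadditivity of the Cantor function. -/
theorem cantorCdf_add_le {L : ℝ} (hL : 0 < L) (n : ℕ) {x y : ℝ} (hx : 0 ≤ x) (hy : 0 ≤ y) :
    cantorCdf n L (x + y) ≤ cantorCdf n L x + cantorCdf n L y := by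
  induction n generalizing x y with
  | zero =>
    rw [cantorCdf_zero, cantorCdf_zero, cantorCdf_zero]
    grind
  | succ n ih =>
    wlog hxy : y ≤ x generalizing x y
    · rw [add_comm x, add_comm (cantorCdf _ _ x)]
      exact this hy hx (le_of_not_ge hxy)
    rw [cantorCdf_succ hL, cantorCdf_succ hL, cantorCdf_succ hL]
    have hx2 := cantorCdf_nonneg n L (3 * x - 2 * L)
    have hy2 := cantorCdf_nonneg n L (3 * y - 2 * L)
    rcases le_total (3 * (x + y)) (2 * L) with h | h
    · have h0 := cantorCdf_of_nonpos hL.le n (sub_nonpos.2 h)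
      have h1 := ih (x := 3 * x) (y := 3 * y) (by positivity) (by positivity)
      rw [← mul_add] at h1
      linarith
    · have h0 : cantorCdf n L (3 * (x + y)) = cantorCdf n L (3 * x) := by
        rw [cantorCdf_of_ge hL.le n (by linarith : L ≤ 3 * (x + y)),
          cantorCdf_of_ge hL.le n (by linarith : L ≤ 3 * x)]
      have h1 : cantorCdf n L (3 * (x + y) - 2 * L) ≤
          cantorCdf n L (3 * y) + cantorCdf n L (3 * x - 2 * L) := by
        rcases le_total 0 (3 * x - 2 * L) with h' | h'
        · have := ih (x := 3 * y) (y := 3 * x - 2 * L) (by positivity) h'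
          rwa [show 3 * y + (3 * x - 2 * L) = 3 * (x + y) - 2 * L by ring] at this
        · have := cantorCdf_mono n L (show 3 * (x + y) - 2 * L ≤ 3 * y by linarith)
          linarith
      linarith

/-- Among all windows of a given length, the initial one captures the most of `C_n(L)`. -/
theorem volume_cantorIterate_inter_Icc_le {L : ℝ} (hL : 0 < L) (n : ℕ) {a b : ℝ} (ha : 0 ≤ a)
    (hab : a ≤ b) :
    volume (cantorIterate n L ∩ Set.Icc a b) ≤ volume (cantorIterate n L ∩ Set.Iio (b - a)) := by
  have hfin : ∀ s, volume (cantorIterate n L ∩ s) ≠ ⊤ := fun s =>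
    (measure_inter_lt_top_of_left_ne_top (isCompact_cantorIterate L n).measure_lt_top.ne).ne
  have hm := (isCompact_cantorIterate L n).measurableSet
  have hsplit : cantorIterate n L ∩ Set.Iic b =
      cantorIterate n L ∩ Set.Iic a ∪ cantorIterate n L ∩ Set.Ioc a b := by
    rw [← Set.inter_union_distrib_left, Set.Iic_union_Ioc_eq_Iic hab]
  have hdisj : Disjoint (cantorIterate n L ∩ Set.Iic a) (cantorIterate n L ∩ Set.Ioc a b) :=
    (Set.Iic_disjoint_Ioc le_rfl).mono Set.inter_subset_right Set.inter_subset_right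
  have hcdf : cantorCdf n L b = cantorCdf n L a +
      volume.real (cantorIterate n L ∩ Set.Ioc a b) := by
    rw [cantorCdf, cantorCdf, hsplit, measureReal_union hdisj (hm.inter measurableSet_Ioc)
      (hfin _) (hfin _)]
  have hsub := cantorCdf_add_le hL n ha (sub_nonneg.2 hab)
  rw [add_sub_cancel] at hsub
  rw [← measure_congr ((Filter.EventuallyEq.refl _ (cantorIterate n L)).inter Ioc_ae_eq_Icc),
    measure_congr ((Filter.EventuallyEq.refl _ (cantorIterate n L)).inter Iio_ae_eq_Iic),
    ← ENNReal.toReal_le_toReal (hfin _) (hfin _)]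
  change volume.real _ ≤ cantorCdf n L (b - a)
  linarith

/-- The function `r ↦ r ^ k * exp (-r)` increases up to its mode `k`. -/
theorem monotoneOn_pow_mul_exp_neg (k : ℕ) :
    MonotoneOn (fun r : ℝ => r ^ k * exp (-r)) (Set.Icc 0 k) := by
  rintro x ⟨hx, -⟩ y ⟨hy, hyk⟩ hxy
  rcases hy.eq_or_lt with rfl | hy
  · rw [le_antisymm hxy hx]
  have h1 : x / y ≤ exp (-((y - x) / y)) := by
    refine le_trans (le_of_eq ?_) (Real.add_one_le_exp _)
    field_simp
    ring
  have h2 : (x / y) ^ k ≤ exp (x - y) := by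
    refine (pow_le_pow_left₀ (by positivity) h1 k).trans ?_
    rw [← Real.exp_nat_mul, Real.exp_le_exp, mul_neg, ← neg_sub y x, neg_le_neg_iff, mul_div_assoc',
      le_div_iff₀ hy, mul_comm]
    exact mul_le_mul_of_nonneg_right hyk (by linarith)
  rw [div_pow, div_le_iff₀ (by positivity)] at h2
  calc x ^ k * exp (-x) ≤ exp (x - y) * y ^ k * exp (-x) := by gcongr
    _ = y ^ k * (exp (x - y) * exp (-x)) := by ring
    _ = y ^ k * exp (-y) := by rw [← Real.exp_add]; congr 2; ring

theorem one_sub_mul_exp_le {u : ℝ} (hu : 0 ≤ u) : (1 - u) * exp u ≤ (1 + u) * exp (-u) := by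
  have hd : ∀ v : ℝ, HasDerivAt (fun u => (1 + u) * exp (-u) - (1 - u) * exp u)
      (v * (exp v - exp (-v))) v := by
    intro v
    convert! (((hasDerivAt_id v).const_add 1).mul (hasDerivAt_neg v).exp).sub
      (((hasDerivAt_id v).const_sub 1).mul (Real.hasDerivAt_exp v)) using 1
    simp only [id]
    ring
  have hmono : MonotoneOn (fun u => (1 + u) * exp (-u) - (1 - u) * exp u) (Set.Ici 0) := by
    refine monotoneOn_of_hasDerivWithinAt_nonneg (convex_Ici 0)
      (fun v _ => (hd v).continuousAt.continuousWithinAt)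
      (fun v _ => (hd v).hasDerivWithinAt) fun v hv => ?_
    rw [interior_Ici, Set.mem_Ioi] at hv
    exact mul_nonneg hv.le (sub_nonneg.2 (Real.exp_le_exp.2 (by linarith)))
  have := hmono Set.self_mem_Ici hu hu
  simp only [add_zero, neg_zero, sub_zero, sub_self] at this
  linarith

/-- The right flank of `r ↦ r ^ k * exp (-r)` at its mode `k` dominates the reflected left one. -/
theorem sub_pow_mul_exp_neg_le (k : ℕ) {x : ℝ} (hx : 0 ≤ x) (hxk : x ≤ k) :
    (k - x) ^ k * exp (-(k - x)) ≤ (x + k) ^ k * exp (-(x + k)) := by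
  rcases Nat.eq_zero_or_pos k with rfl | hk
  · rw [Nat.cast_zero] at hxk ⊢
    simp [le_antisymm hxk hx]
  have hk' : (0 : ℝ) < k := Nat.cast_pos.2 hk
  have hu : x / k ≤ 1 := (div_le_one hk').2 hxk
  have h := pow_le_pow_left₀ (mul_nonneg (sub_nonneg.2 hu) (exp_pos _).le)
    (one_sub_mul_exp_le (div_nonneg hx hk'.le)) k
  rw [mul_pow, mul_pow, ← Real.exp_nat_mul, ← Real.exp_nat_mul, mul_neg,
    mul_div_cancel₀ _ hk'.ne'] at h
  have h1 : ((k : ℝ) - x) ^ k = k ^ k * (1 - x / k) ^ k := by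
    rw [← mul_pow, mul_sub, mul_one, mul_div_cancel₀ _ hk'.ne']
  have h2 : (x + (k : ℝ)) ^ k = k ^ k * (1 + x / k) ^ k := by
    rw [← mul_pow, mul_add, mul_one, mul_div_cancel₀ _ hk'.ne', add_comm]
  have h3 : exp (-(k - x)) = exp (-k) * exp x := by rw [← Real.exp_add]; congr 1; ring
  have h4 : exp (-(x + k)) = exp (-k) * exp (-x) := by rw [← Real.exp_add]; congr 1; ring
  calc _ = k ^ k * exp (-k) * ((1 - x / k) ^ k * exp x) := by rw [h1, h3]; ring
    _ ≤ k ^ k * exp (-k) * ((1 + x / k) ^ k * exp (-x)) := by gcongr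
    _ = _ := by rw [h2, h4]; ring

/-- If `f` increases on `[0, k]` and `f (k - x) ≤ f (x + k)` there, then the superlevel sets of `f`
capture at least as much of `C_n(L) + k` as of `C_n(L) ∩ [0, k]`. -/
theorem volume_superlevel_inter_cantorIterate_le {L : ℝ} (hL : 0 < L) (n : ℕ) {k : ℝ}
    {f : ℝ → ℝ} (hf : MonotoneOn f (Set.Icc 0 k))
    (hfk : ∀ x, 0 ≤ x → x ≤ k → f (k - x) ≤ f (x + k)) (t : ℝ) :
    volume ({r | t < f r} ∩ (cantorIterate n L ∩ Set.Icc 0 k)) ≤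
      volume ({r | t < f r} ∩ (fun x => x + k) '' cantorIterate n L) := by
  set S := {r | t < f r} ∩ Set.Icc 0 k with hS
  rcases S.eq_empty_or_nonempty with hempty | hne
  · rw [Set.inter_left_comm, ← hS, hempty, Set.inter_empty, measure_empty]
    exact zero_le
  have hbdd : BddBelow S := ⟨0, fun r hr => hr.2.1⟩
  have h0 : 0 ≤ sInf S := le_csInf hne fun r hr => hr.2.1
  have hle : sInf S ≤ k := hne.elim fun r hr => (csInf_le hbdd hr).trans hr.2.2
  calc _ ≤ volume (cantorIterate n L ∩ Set.Icc (sInf S) k) := by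
        refine measure_mono ?_
        rintro r ⟨hr, hrC, hrk⟩
        exact ⟨hrC, csInf_le hbdd ⟨hr, hrk⟩, hrk.2⟩
    _ ≤ volume (cantorIterate n L ∩ Set.Iio (k - sInf S)) :=
        volume_cantorIterate_inter_Icc_le hL n h0 hle
    _ = volume ((fun x => x + k) '' (cantorIterate n L ∩ Set.Iio (k - sInf S))) := by
        rw [Set.image_add_right, measure_preimage_add_right]
    _ ≤ _ := by
        refine measure_mono ?_
        rintro _ ⟨x, ⟨hxC, hx⟩, rfl⟩
        refine ⟨?_, x, hxC, rfl⟩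
        have hx0 := (cantorIterate_subset_Icc hL.le n hxC).1
        rw [Set.mem_Iio] at hx
        obtain ⟨r, hr, hrx⟩ := exists_lt_of_csInf_lt hne (show sInf S < k - x by linarith)
        exact (lt_of_lt_of_le hr.1 (hf hr.2 ⟨by linarith, by linarith⟩ hrx.le)).trans_le
          (hfk x hx0 (by linarith))

/-- For every `L > 0` and `k, n ∈ ℕ`:
`∫_{C_n(L) ∩ [0,k]} f_k(r) dr ≤ ∫_{C_n(L)+k} f_k(r) dr`. -/
theorem cantor_integral_left_part_le_shifted (L : ℝ) (hL : 0 < L) (k n : ℕ) :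
    (∫ r in cantorIterate n L ∩ Set.Icc (0 : ℝ) (k : ℝ),
        r ^ k / (Nat.factorial k) * Real.exp (-r)) ≤
      ∫ r in (fun x : ℝ => x + (k : ℝ)) '' cantorIterate n L,
        r ^ k / (Nat.factorial k) * Real.exp (-r) := by
  set f : ℝ → ℝ := fun r => r ^ k / (Nat.factorial k) * Real.exp (-r) with hf
  have hfeq : ∀ r, f r = r ^ k * Real.exp (-r) / Nat.factorial k := fun r => by
    rw [hf]; ring
  have hmono : MonotoneOn f (Set.Icc 0 k) := fun x hx y hy hxy => by
    rw [hfeq, hfeq]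
    exact div_le_div_of_nonneg_right (monotoneOn_pow_mul_exp_neg k hx hy hxy) (by positivity)
  have hrefl : ∀ x : ℝ, 0 ≤ x → x ≤ k → f (k - x) ≤ f (x + k) := fun x hx hxk => by
    rw [hfeq, hfeq]
    exact div_le_div_of_nonneg_right (sub_pow_mul_exp_neg_le k hx hxk) (by positivity)
  have hcont : Continuous f := by fun_prop
  have hC := isCompact_cantorIterate L n
  have hA : IsCompact (cantorIterate n L ∩ Set.Icc (0 : ℝ) k) := hC.inter isCompact_Icc
  have hB : IsCompact ((fun x : ℝ => x + k) '' cantorIterate n L) := hC.image (by fun_prop)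
  have hnn : ∀ r, 0 ≤ r → 0 ≤ f r := fun r hr => by positivity
  have hnnA : 0 ≤ᵐ[volume.restrict (cantorIterate n L ∩ Set.Icc (0 : ℝ) k)] f :=
    ae_restrict_of_forall_mem hA.measurableSet fun r hr => hnn r hr.2.1
  have hnnB : 0 ≤ᵐ[volume.restrict ((fun x : ℝ => x + k) '' cantorIterate n L)] f := by
    refine ae_restrict_of_forall_mem hB.measurableSet ?_
    rintro _ ⟨x, hx, rfl⟩
    exact hnn _ (add_nonneg (cantorIterate_subset_Icc hL.le n hx).1 k.cast_nonneg)
  have hintA := hcont.continuousOn.integrableOn_compact (μ := volume) hA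
  have hintB := hcont.continuousOn.integrableOn_compact (μ := volume) hB
  rw [← ENNReal.ofReal_le_ofReal_iff (integral_nonneg_of_ae hnnB),
    ofReal_integral_eq_lintegral_ofReal hintA hnnA, ofReal_integral_eq_lintegral_ofReal hintB hnnB,
    lintegral_eq_lintegral_meas_lt _ hnnA hcont.aemeasurable,
    lintegral_eq_lintegral_meas_lt _ hnnB hcont.aemeasurable]
  refine lintegral_mono fun t => ?_
  rw [Measure.restrict_apply' hA.measurableSet, Measure.restrict_apply' hB.measurableSet]
  exact volume_superlevel_inter_cantorIterate_le hL n hmono hrefl t
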